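/- There is no plateau of F at the endpoints: F(x) > 0 for every x ∈ (0,1], and (by the symmetry F(x) + F(1−x) = 1) F(x) < 1 for every x ∈ [0,1). -/

import Mathlib

open Real MeasureTheory Filter Topology

noncomputable section

/-- The Thue–Morse correlation coefficients: `η 0 = 1`, `η 1 = -1/3`,
and for `m ≥ 1`, `η (2m) = η m` and `η (2m+1) = -(η m + η (m+1))/2`. -/
def eta : ℕ → ℝ
  | 0 => 1
  | 1 => -(1 / 3)
  | n + 2 =>
    if (n + 2) % 2 = 0 then eta ((n + 2) / 2)
    else -(eta ((n + 2) / 2) + eta ((n + 2) / 2 + 1)) / 2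
  decreasing_by all_goals omega

/-- The Thue–Morse distribution function
`F(x) = x + ∑_{m≥1} (η(m)/(mπ))·sin(2πmx)`. -/
def F (x : ℝ) : ℝ :=
  x + ∑' m : ℕ, eta (m + 1) / ((m + 1 : ℝ) * π) * Real.sin (2 * π * (m + 1) * x)

/-- The two-scale recursion of which `eta` is a fixed point. -/
def twoScale (c : ℕ → ℝ) (m : ℕ) : ℝ :=
  if m % 2 = 0 then c (m / 2) else -(c (m / 2) + c (m / 2 + 1)) / 2

lemma twoScale_even (c : ℕ → ℝ) (m : ℕ) : twoScale c (2 * m) = c m := by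
  simp [twoScale]

lemma twoScale_odd (c : ℕ → ℝ) (m : ℕ) :
    twoScale c (2 * m + 1) = -(c m + c (m + 1)) / 2 := by
  have h1 : (2 * m + 1) % 2 ≠ 0 := by omega
  have h2 : (2 * m + 1) / 2 = m := by omega
  rw [twoScale, if_neg h1, h2]

lemma twoScale_eta (m : ℕ) : twoScale eta m = eta m := by
  match m with
  | 0 => simp [twoScale]
  | 1 =>
    rw [twoScale]
    norm_num [eta]
  | n + 2 =>
    rw [eta]
    rfl

/-- Fourier coefficients of the `N`-th Riesz product approximating the Thue–Morse measure. -/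
def approxCoeff : ℕ → ℕ → ℝ
  | 0 => fun m => if m = 0 then 1 else if m = 1 then -(1 / 3) else 0
  | N + 1 => twoScale (approxCoeff N)

lemma approxCoeff_eq_eta (N m : ℕ) (hm : m ≤ 2 ^ N) : approxCoeff N m = eta m := by
  induction N generalizing m with
  | zero =>
    have : m = 0 ∨ m = 1 := by simp at hm; omega
    rcases this with rfl | rfl <;> simp [approxCoeff, eta]
  | succ N ih =>
    rw [← twoScale_eta, approxCoeff]
    have h2 : 2 ^ (N + 1) = 2 * 2 ^ N := by ring
    rw [h2] at hm
    obtain ⟨k, rfl | rfl⟩ := Nat.even_or_odd' m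
    · rw [twoScale_even, twoScale_even, ih k (by omega)]
    · rw [twoScale_odd, twoScale_odd, ih k (by omega), ih (k + 1) (by omega)]

lemma approxCoeff_eq_zero (N m : ℕ) (hm : 2 ^ (N + 1) ≤ m) : approxCoeff N m = 0 := by
  induction N generalizing m with
  | zero =>
    have h0 : m ≠ 0 := by rintro rfl; simp at hm
    have h1 : m ≠ 1 := by rintro rfl; simp at hm
    simp [approxCoeff, h0, h1]
  | succ N ih =>
    rw [approxCoeff]
    have h2 : 2 ^ (N + 1 + 1) = 2 * 2 ^ (N + 1) := by ring
    rw [h2] at hm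
    obtain ⟨k, rfl | rfl⟩ := Nat.even_or_odd' m
    · rw [twoScale_even, ih k (by omega)]
    · rw [twoScale_odd, ih k (by omega), ih (k + 1) (by omega)]
      simp

lemma approxCoeff_zero (N : ℕ) : approxCoeff N 0 = 1 := by
  rw [approxCoeff_eq_eta N 0 (Nat.zero_le _), eta]

lemma sum_range_two_mul (f : ℕ → ℝ) (M : ℕ) :
    ∑ m ∈ Finset.range (2 * M), f m = ∑ m ∈ Finset.range M, (f (2 * m) + f (2 * m + 1)) := by
  induction M with
  | zero => simp
  | succ M ih =>
    rw [mul_add, mul_one, Finset.sum_range_succ, Finset.sum_range_succ, ih,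
      Finset.sum_range_succ]
    ring

lemma sum_abs_succ_le {c : ℕ → ℝ} {B : ℝ}
    (h : ∀ M, ∑ m ∈ Finset.range M, |c m| ≤ B) (M : ℕ) :
    ∑ m ∈ Finset.range M, |c (m + 1)| ≤ B := by
  have := h (M + 1)
  rw [Finset.sum_range_succ'] at this
  linarith [abs_nonneg (c 0)]

lemma sum_abs_twoScale_le {c : ℕ → ℝ} {B : ℝ}
    (h : ∀ M, ∑ m ∈ Finset.range M, |c m| ≤ B) (M : ℕ) :
    ∑ m ∈ Finset.range M, |twoScale c m| ≤ 2 * B := by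
  calc ∑ m ∈ Finset.range M, |twoScale c m|
      ≤ ∑ m ∈ Finset.range (2 * M), |twoScale c m| :=
        Finset.sum_le_sum_of_subset_of_nonneg (Finset.range_subset_range.2 (by omega))
          fun _ _ _ => abs_nonneg _
    _ = ∑ m ∈ Finset.range M, (|c m| + |(c m + c (m + 1)) / 2|) := by
        rw [sum_range_two_mul]
        refine Finset.sum_congr rfl fun m _ => ?_
        rw [twoScale_even, twoScale_odd, neg_div, abs_neg]
    _ ≤ ∑ m ∈ Finset.range M, (3 / 2 * |c m| + 1 / 2 * |c (m + 1)|) := by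
        refine Finset.sum_le_sum fun m _ => ?_
        rw [abs_div, abs_two]
        linarith [abs_add_le (c m) (c (m + 1))]
    _ ≤ 2 * B := by
        rw [Finset.sum_add_distrib, ← Finset.mul_sum, ← Finset.mul_sum]
        linarith [h M, sum_abs_succ_le h M]

/-- Applying the recursion twice expands the `ℓ¹` norm by a factor of at most `3`. -/
lemma sum_abs_twoScale_twoScale_le {c : ℕ → ℝ} {B : ℝ}
    (h : ∀ M, ∑ m ∈ Finset.range M, |c m| ≤ B) (M : ℕ) :
    ∑ m ∈ Finset.range M, |twoScale (twoScale c) m| ≤ 3 * B := by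
  calc ∑ m ∈ Finset.range M, |twoScale (twoScale c) m|
      ≤ ∑ m ∈ Finset.range (2 * (2 * M)), |twoScale (twoScale c) m| :=
        Finset.sum_le_sum_of_subset_of_nonneg (Finset.range_subset_range.2 (by omega))
          fun _ _ _ => abs_nonneg _
    _ = ∑ m ∈ Finset.range M, (|c m| + |(c m - c (m + 1)) / 4| +
          (|(c m + c (m + 1)) / 2| + |(c m - c (m + 1)) / 4|)) := by
        rw [sum_range_two_mul, sum_range_two_mul]
        refine Finset.sum_congr rfl fun m _ => ?_
        have e : 2 * m + 1 + 1 = 2 * (m + 1) := by ring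
        simp only [twoScale_even, twoScale_odd, e]
        congr 2
        · rw [← abs_neg]
          congr 1
          ring
        · rw [← abs_neg]
          congr 1
          ring
        · congr 1
          ring
    _ ≤ ∑ m ∈ Finset.range M, (2 * |c m| + |c (m + 1)|) := by
        refine Finset.sum_le_sum fun m _ => ?_
        rw [abs_div, abs_div, abs_two, abs_of_pos (by norm_num : (0 : ℝ) < 4)]
        linarith [abs_add_le (c m) (c (m + 1)), abs_sub (c m) (c (m + 1))]
    _ ≤ 3 * B := by
        rw [Finset.sum_add_distrib, ← Finset.mul_sum]
        linarith [h M, sum_abs_succ_le h M]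

lemma twoScale_sub (c d : ℕ → ℝ) : twoScale (c - d) = twoScale c - twoScale d := by
  ext m
  simp only [twoScale, Pi.sub_apply]
  split_ifs <;> ring

lemma sum_abs_approxCoeff_sub_le (N : ℕ) : ∀ M,
    ∑ m ∈ Finset.range M, |(approxCoeff (N + 1) - approxCoeff N) m| ≤ 8 * (7 / 4) ^ N := by
  have h0 : ∀ M, ∑ m ∈ Finset.range M, |approxCoeff 0 m| ≤ 4 / 3 := by
    intro M
    calc ∑ m ∈ Finset.range M, |approxCoeff 0 m|
        ≤ ∑ m ∈ Finset.range (M + 2), |approxCoeff 0 m| :=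
          Finset.sum_le_sum_of_subset_of_nonneg (Finset.range_subset_range.2 (by omega))
            fun _ _ _ => abs_nonneg _
      _ = 4 / 3 := by
          rw [Finset.sum_range_succ', Finset.sum_range_succ']
          norm_num [approxCoeff, abs_of_pos]
  have h1 : ∀ M, ∑ m ∈ Finset.range M, |(approxCoeff (0 + 1) - approxCoeff 0) m| ≤ 4 := by
    intro M
    have h := sum_abs_twoScale_le h0 M
    calc _ ≤ ∑ m ∈ Finset.range M, (|twoScale (approxCoeff 0) m| + |approxCoeff 0 m|) :=
          Finset.sum_le_sum fun m _ => abs_sub _ _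
      _ ≤ 4 := by
          rw [Finset.sum_add_distrib]
          linarith [h0 M]
  have hs : ∀ N, approxCoeff (N + 1 + 1) - approxCoeff (N + 1) =
      twoScale (approxCoeff (N + 1) - approxCoeff N) := by
    intro N
    rw [twoScale_sub]
    rfl
  induction N using Nat.twoStepInduction with
  | zero => intro M; linarith [h1 M]
  | one =>
    intro M
    rw [hs]
    linarith [sum_abs_twoScale_le h1 M]
  | more N ih _ =>
    intro M
    rw [hs, hs]
    refine (sum_abs_twoScale_twoScale_le ih M).trans ?_
    have : (0 : ℝ) ≤ (7 / 4) ^ N := by positivity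
    rw [pow_add]
    linarith

lemma sum_abs_approxCoeff_sub_div_le (N M : ℕ) :
    ∑ m ∈ Finset.range M,
      |(approxCoeff (N + 1) - approxCoeff N) (m + 1)| / (m + 1 : ℝ) ≤ 8 * (7 / 8) ^ N := by
  calc _ ≤ ∑ m ∈ Finset.range M, |(approxCoeff (N + 1) - approxCoeff N) (m + 1)| / 2 ^ N := by
        refine Finset.sum_le_sum fun m _ => ?_
        by_cases hm : m + 1 ≤ 2 ^ N
        · rw [Pi.sub_apply, approxCoeff_eq_eta N _ hm,
            approxCoeff_eq_eta (N + 1) _ (hm.trans (Nat.pow_le_pow_right (by norm_num) (by omega)))]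
          simp
        · have : (2 : ℝ) ^ N ≤ m + 1 := by exact_mod_cast (not_le.1 hm).le
          gcongr
    _ ≤ 8 * (7 / 4) ^ N / 2 ^ N := by
        rw [← Finset.sum_div]
        gcongr
        exact sum_abs_succ_le (sum_abs_approxCoeff_sub_le N) M
    _ = 8 * (7 / 8) ^ N := by
        rw [mul_div_assoc, ← div_pow]
        norm_num

/-- The `m`-th term of the sine series with coefficients `c`. -/
def sineSeriesTerm (c : ℕ → ℝ) (x : ℝ) (m : ℕ) : ℝ :=
  c (m + 1) / ((m + 1 : ℝ) * π) * Real.sin (2 * π * (m + 1) * x)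

/-- The distribution function of the `N`-th Riesz product. -/
def approxF (N : ℕ) (x : ℝ) : ℝ :=
  x + ∑ m ∈ Finset.range (2 ^ (N + 1)), sineSeriesTerm (approxCoeff N) x m

lemma sineSeriesTerm_sub (c d : ℕ → ℝ) (x : ℝ) (m : ℕ) :
    sineSeriesTerm (c - d) x m = sineSeriesTerm c x m - sineSeriesTerm d x m := by
  simp only [sineSeriesTerm, Pi.sub_apply]
  ring

lemma abs_sineSeriesTerm_le (c : ℕ → ℝ) (x : ℝ) (m : ℕ) :
    |sineSeriesTerm c x m| ≤ |c (m + 1)| / (m + 1 : ℝ) := by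
  rw [sineSeriesTerm, abs_mul, abs_div, abs_of_pos (by positivity : (0 : ℝ) < (m + 1) * π)]
  have hm : (0 : ℝ) < m + 1 := by positivity
  calc _ ≤ |c (m + 1)| / ((m + 1) * π) * 1 := by
        gcongr
        exact Real.abs_sin_le_one _
    _ ≤ |c (m + 1)| / (m + 1 : ℝ) := by
        rw [mul_one]
        gcongr
        nlinarith [Real.pi_gt_three]

lemma hasSum_sineSeriesTerm_approxCoeff (N : ℕ) (x : ℝ) :
    HasSum (sineSeriesTerm (approxCoeff N) x) (approxF N x - x) := by
  rw [approxF, add_sub_cancel_left]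
  refine hasSum_sum_of_ne_finset_zero fun m hm => ?_
  rw [Finset.mem_range, not_lt] at hm
  rw [sineSeriesTerm, approxCoeff_eq_zero N (m + 1) (by omega)]
  simp

lemma summable_sineSeriesTerm_approxCoeff_sub (x : ℝ) :
    Summable fun p : ℕ × ℕ => sineSeriesTerm (approxCoeff (p.1 + 1) - approxCoeff p.1) x p.2 := by
  have hnn : ∀ N m : ℕ,
      0 ≤ |(approxCoeff (N + 1) - approxCoeff N) (m + 1)| / (m + 1 : ℝ) := by
    intro N m
    positivity
  have h : Summable fun p : ℕ × ℕ =>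
      |(approxCoeff (p.1 + 1) - approxCoeff p.1) (p.2 + 1)| / (p.2 + 1 : ℝ) := by
    rw [summable_prod_of_nonneg fun p => hnn p.1 p.2]
    refine ⟨fun N => summable_of_sum_range_le (hnn N) (sum_abs_approxCoeff_sub_div_le N), ?_⟩
    refine Summable.of_nonneg_of_le (fun N => tsum_nonneg (hnn N))
      (fun N => Real.tsum_le_of_sum_range_le (hnn N) (sum_abs_approxCoeff_sub_div_le N)) ?_
    exact (summable_geometric_of_lt_one (by norm_num) (by norm_num)).mul_left 8
  exact Summable.of_norm_bounded h fun p => abs_sineSeriesTerm_le _ x p.2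

lemma tendsto_approxF (x : ℝ) : Tendsto (fun N => approxF N x) atTop (𝓝 (F x)) := by
  obtain ⟨S, hS⟩ := summable_sineSeriesTerm_approxCoeff_sub x
  have h1 : HasSum (fun N => approxF (N + 1) x - approxF N x) S := by
    refine hS.prod_fiberwise fun N => ?_
    have := (hasSum_sineSeriesTerm_approxCoeff (N + 1) x).sub (hasSum_sineSeriesTerm_approxCoeff N x)
    simp only [sub_sub_sub_cancel_right] at this
    simpa only [sineSeriesTerm_sub] using this
  have h2 : HasSum (fun m => sineSeriesTerm eta x m - sineSeriesTerm (approxCoeff 0) x m) S := by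
    have hswap := (Equiv.prodComm ℕ ℕ).hasSum_iff.2 hS
    refine hswap.prod_fiberwise fun m => ?_
    have key : sineSeriesTerm eta x m - sineSeriesTerm (approxCoeff 0) x m =
        ∑ N ∈ Finset.range (m + 1), sineSeriesTerm (approxCoeff (N + 1) - approxCoeff N) x m := by
      simp only [sineSeriesTerm_sub]
      rw [Finset.sum_range_sub (fun N => sineSeriesTerm (approxCoeff N) x m)]
      simp only [sineSeriesTerm]
      rw [approxCoeff_eq_eta (m + 1) (m + 1) Nat.lt_two_pow_self.le]
    rw [key]
    refine hasSum_sum_of_ne_finset_zero fun N hN => ?_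
    rw [Finset.mem_range, not_lt] at hN
    have hlt : N < 2 ^ N := Nat.lt_two_pow_self
    have hle : 2 ^ N ≤ 2 ^ (N + 1) := Nat.pow_le_pow_right (by norm_num) (by omega)
    simp only [Function.comp, Equiv.prodComm_apply, Prod.swap]
    rw [sineSeriesTerm, Pi.sub_apply, approxCoeff_eq_eta N _ (by omega),
      approxCoeff_eq_eta (N + 1) _ (by omega)]
    simp
  have h3 : F x = x + (S + (approxF 0 x - x)) := by
    have := (h2.add (hasSum_sineSeriesTerm_approxCoeff 0 x)).tsum_eq
    simp only [sub_add_cancel] at this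
    rw [← this]
    rfl
  have h4 := h1.tendsto_sum_nat.add_const (approxF 0 x)
  simp only [Finset.sum_range_sub (fun N => approxF N x), sub_add_cancel] at h4
  rw [h3]
  convert h4 using 2
  ring

/-- The density of the `N`-th Riesz product. -/
def approxDensity (N : ℕ) (x : ℝ) : ℝ :=
  2 * ∑ m ∈ Finset.range (2 ^ (N + 1)), approxCoeff N m * Real.cos (m * (2 * π * x)) - 1

lemma hasDerivAt_approxF (N : ℕ) (x : ℝ) :
    HasDerivAt (approxF N) (approxDensity N x) x := by
  have hterm : ∀ m ∈ Finset.range (2 ^ (N + 1)),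
      HasDerivAt (fun y => sineSeriesTerm (approxCoeff N) y m)
        (2 * (approxCoeff N (m + 1) * Real.cos ((m + 1 : ℕ) * (2 * π * x)))) x := by
    intro m _
    have h := (((hasDerivAt_id x).const_mul (2 * π * (m + 1 : ℝ))).sin).const_mul
      (approxCoeff N (m + 1) / ((m + 1 : ℝ) * π))
    refine h.congr_deriv ?_
    have hm : (m + 1 : ℝ) ≠ 0 := by positivity
    have hpi := Real.pi_ne_zero
    have e : ((m + 1 : ℕ) : ℝ) * (2 * π * x) = 2 * π * (m + 1) * x := by push_cast; ring
    rw [e]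
    simp only [id]
    field_simp
  have h := (hasDerivAt_id x).add (HasDerivAt.fun_sum hterm)
  refine h.congr_deriv ?_
  have hs := Finset.sum_range_succ'
    (fun m => approxCoeff N m * Real.cos (m * (2 * π * x))) (2 ^ (N + 1))
  rw [Finset.sum_range_succ, approxCoeff_eq_zero N _ le_rfl, approxCoeff_zero] at hs
  rw [approxDensity, ← Finset.mul_sum]
  simp only [zero_mul, add_zero, Nat.cast_zero, Real.cos_zero, mul_one] at hs
  rw [hs]
  ring

lemma twoScale_cos_sum (c : ℕ → ℝ) (θ : ℝ) (M : ℕ) :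
    2 * ∑ m ∈ Finset.range (2 * M), twoScale c m * Real.cos (m * θ) - c 0 =
      (1 - Real.cos θ) * (2 * ∑ m ∈ Finset.range M, c m * Real.cos (m * (2 * θ)) - c 0) -
        c M * Real.cos (2 * M * θ - θ) := by
  rw [sum_range_two_mul]
  induction M with
  | zero =>
    simp
    ring
  | succ M ih =>
    rw [Finset.sum_range_succ, Finset.sum_range_succ, twoScale_even, twoScale_odd]
    have e1 : ((2 * M : ℕ) : ℝ) * θ = 2 * M * θ := by push_cast; ring
    have e2 : ((2 * M + 1 : ℕ) : ℝ) * θ = 2 * M * θ + θ := by push_cast; ring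
    have e3 : 2 * ((M + 1 : ℕ) : ℝ) * θ - θ = 2 * M * θ + θ := by push_cast; ring
    have e4 : (M : ℝ) * (2 * θ) = 2 * M * θ := by ring
    rw [e1, e2, e3, e4]
    rw [Real.cos_sub] at ih
    rw [Real.cos_add]
    linear_combination ih

lemma approxDensity_succ (N : ℕ) (x : ℝ) :
    approxDensity (N + 1) x = (1 - Real.cos (2 * π * x)) * approxDensity N (2 * x) := by
  have h := twoScale_cos_sum (approxCoeff N) (2 * π * x) (2 ^ (N + 1))
  rw [approxCoeff_eq_zero N _ le_rfl, approxCoeff_zero] at h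
  have e1 : 2 * 2 ^ (N + 1) = 2 ^ (N + 1 + 1) := by ring
  have e2 : 2 * (2 * π * x) = 2 * π * (2 * x) := by ring
  rw [e1, e2, zero_mul, sub_zero] at h
  exact h

lemma approxDensity_nonneg (N : ℕ) (x : ℝ) : 0 ≤ approxDensity N x := by
  induction N generalizing x with
  | zero =>
    simp only [approxDensity, approxCoeff, zero_add, pow_one, Finset.sum_range_succ,
      Finset.sum_range_zero]
    norm_num
    linarith [Real.cos_le_one (2 * π * x)]
  | succ N ih =>
    rw [approxDensity_succ]
    exact mul_nonneg (sub_nonneg.2 (Real.cos_le_one _)) (ih _)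

lemma hasDerivAt_approxF_two_mul (N : ℕ) (x : ℝ) :
    HasDerivAt (fun y => approxF N (2 * y) / 2) (approxDensity N (2 * x)) x := by
  have h := ((hasDerivAt_approxF N (2 * x)).comp x ((hasDerivAt_id x).const_mul 2)).div_const 2
  refine h.congr_deriv ?_
  ring

lemma F_mono : Monotone F := by
  intro x y hxy
  refine le_of_tendsto_of_tendsto' (tendsto_approxF x) (tendsto_approxF y) fun N => ?_
  exact monotone_of_deriv_nonneg (fun z => (hasDerivAt_approxF N z).differentiableAt)
    (fun z => by rw [(hasDerivAt_approxF N z).deriv]; exact approxDensity_nonneg N z) hxy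

lemma le_F_sub_F {K a b : ℝ} (hab : a ≤ b)
    (h : ∀ x ∈ Set.Icc a b, K ≤ 1 - Real.cos (2 * π * x)) :
    K * ((F (2 * b) - F (2 * a)) / 2) ≤ F b - F a := by
  refine le_of_tendsto_of_tendsto'
    ((((tendsto_approxF (2 * b)).sub (tendsto_approxF (2 * a))).div_const 2).const_mul K)
    (((tendsto_approxF b).sub (tendsto_approxF a)).comp (tendsto_add_atTop_nat 1)) fun N => ?_
  have hd : ∀ x, HasDerivAt (fun y => approxF (N + 1) y - K * (approxF N (2 * y) / 2))
      (approxDensity (N + 1) x - K * approxDensity N (2 * x)) x := fun x =>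
    (hasDerivAt_approxF (N + 1) x).sub ((hasDerivAt_approxF_two_mul N x).const_mul K)
  have hm : MonotoneOn (fun y => approxF (N + 1) y - K * (approxF N (2 * y) / 2))
      (Set.Icc a b) := by
    refine monotoneOn_of_deriv_nonneg (convex_Icc a b)
      (fun x _ => (hd x).continuousAt.continuousWithinAt)
      (fun x _ => (hd x).differentiableAt.differentiableWithinAt) fun x hx => ?_
    rw [(hd x).deriv, approxDensity_succ, ← sub_mul]
    exact mul_nonneg (sub_nonneg.2 (h x (interior_subset hx))) (approxDensity_nonneg _ _)
  have := hm (Set.left_mem_Icc.2 hab) (Set.right_mem_Icc.2 hab) hab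
  simp only [Function.comp] at this ⊢
  linarith

lemma F_sub_F_le {K a b : ℝ} (hab : a ≤ b)
    (h : ∀ x ∈ Set.Icc a b, 1 - Real.cos (2 * π * x) ≤ K) :
    F b - F a ≤ K * ((F (2 * b) - F (2 * a)) / 2) := by
  refine le_of_tendsto_of_tendsto'
    (((tendsto_approxF b).sub (tendsto_approxF a)).comp (tendsto_add_atTop_nat 1))
    ((((tendsto_approxF (2 * b)).sub (tendsto_approxF (2 * a))).div_const 2).const_mul K)
    fun N => ?_
  have hd : ∀ x, HasDerivAt (fun y => K * (approxF N (2 * y) / 2) - approxF (N + 1) y)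
      (K * approxDensity N (2 * x) - approxDensity (N + 1) x) x := fun x =>
    ((hasDerivAt_approxF_two_mul N x).const_mul K).sub (hasDerivAt_approxF (N + 1) x)
  have hm : MonotoneOn (fun y => K * (approxF N (2 * y) / 2) - approxF (N + 1) y)
      (Set.Icc a b) := by
    refine monotoneOn_of_deriv_nonneg (convex_Icc a b)
      (fun x _ => (hd x).continuousAt.continuousWithinAt)
      (fun x _ => (hd x).differentiableAt.differentiableWithinAt) fun x hx => ?_
    rw [(hd x).deriv, approxDensity_succ, ← sub_mul]
    exact mul_nonneg (sub_nonneg.2 (h x (interior_subset hx))) (approxDensity_nonneg _ _)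
  have := hm (Set.left_mem_Icc.2 hab) (Set.right_mem_Icc.2 hab) hab
  simp only [Function.comp] at this ⊢
  linarith

lemma F_zero : F 0 = 0 := by
  simp [F]

lemma F_one_sub (x : ℝ) : F (1 - x) = 1 - F x := by
  have h : ∀ m : ℕ, Real.sin (2 * π * (m + 1) * (1 - x)) =
      -Real.sin (2 * π * (m + 1) * x) := by
    intro m
    have e : 2 * π * (m + 1) * (1 - x) = (m + 1 : ℕ) * (2 * π) - 2 * π * (m + 1) * x := by
      push_cast
      ring
    rw [e, Real.sin_nat_mul_two_pi_sub]
  simp only [F, h, mul_neg, tsum_neg]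
  ring

lemma F_quarter_le : F (1 / 4) ≤ 1 / 2 := by
  have h := F_sub_F_le (K := 1) (a := 0) (b := 1 / 4) (by norm_num) fun x hx => by
    have := Real.cos_nonneg_of_neg_pi_div_two_le_of_le (x := 2 * π * x)
      (by nlinarith [Real.pi_pos, hx.1]) (by nlinarith [Real.pi_pos, hx.2])
    linarith
  have h1 : F (2 * (1 / 4)) ≤ F 1 := F_mono (by norm_num)
  have h2 := F_one_sub 0
  rw [sub_zero, F_zero] at h2
  rw [mul_zero, F_zero] at h
  linarith

lemma F_dyadic_lt (n : ℕ) : F ((1 / 2) ^ n / 4) < F ((1 / 2) ^ n) := by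
  induction n with
  | zero =>
    have h2 := F_one_sub 0
    rw [sub_zero, F_zero] at h2
    rw [pow_zero]
    linarith [F_quarter_le]
  | succ n ih =>
    have hpos : (0 : ℝ) < (1 / 2) ^ (n + 1) := by positivity
    have hle : ((1 : ℝ) / 2) ^ (n + 1) ≤ 1 / 2 := by
      rw [pow_succ]
      have : ((1 : ℝ) / 2) ^ n ≤ 1 := pow_le_one₀ (by norm_num) (by norm_num)
      linarith
    set d : ℝ := (1 / 2) ^ (n + 1) with hd
    have hn : (1 / 2 : ℝ) ^ n = 2 * d := by rw [hd, pow_succ]; ring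
    have h := le_F_sub_F (K := 1 - Real.cos (2 * π * (d / 4))) (a := d / 4) (b := d)
      (by linarith) fun x hx => by
        have := Real.cos_le_cos_of_nonneg_of_le_pi (x := 2 * π * (d / 4)) (y := 2 * π * x)
          (by positivity) (by nlinarith [Real.pi_pos, hx.2])
          (by nlinarith [Real.pi_pos, hx.1])
        linarith
    have hc : Real.cos (2 * π * (d / 4)) < 1 := by
      rw [← Real.cos_zero]
      exact Real.cos_lt_cos_of_nonneg_of_le_pi le_rfl (by nlinarith [Real.pi_pos])
        (by positivity)
    rw [hn, mul_div_assoc] at ih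
    have := mul_pos (sub_pos.2 hc) (half_pos (sub_pos.2 ih))
    linarith

lemma F_pos {x : ℝ} (hx : 0 < x) : 0 < F x := by
  obtain ⟨n, hn⟩ := exists_pow_lt_of_lt_one hx (by norm_num : (1 / 2 : ℝ) < 1)
  calc 0 = F 0 := F_zero.symm
    _ ≤ F ((1 / 2) ^ n / 4) := F_mono (by positivity)
    _ < F ((1 / 2) ^ n) := F_dyadic_lt n
    _ ≤ F x := F_mono hn.le

/-- no plateau at the endpoints: `F(x) > 0` for `x ∈ (0,1]` and
`F(x) < 1` for `x ∈ [0,1)`. -/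
theorem F_no_endpoint_plateau :
    (∀ x : ℝ, 0 < x → x ≤ 1 → 0 < F x) ∧
    (∀ x : ℝ, 0 ≤ x → x < 1 → F x < 1) := by
  refine ⟨fun x hx _ => F_pos hx, fun x _ hx => ?_⟩
  have h := F_pos (sub_pos.2 hx)
  rw [F_one_sub] at h
  linarith
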